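/- arXiv:0711.0596 — 2 statements merged into one kernel-verified Lean document; each statement's English description precedes it below -/
import Mathlib

section
/- Let K be a field, let n ≥ 1, and let w₁, w₂, w₃, w₄ ∈ (Fin n →₀ ℕ) be nonzero words. Let S be the quotient of (Fin n →₀ ℕ) by the additive congruence generated by the two pairs (w₁, w₂) and (w₃, w₄), and assume the two defining relations are independent: the pair (w₁, w₂) is not identified by the additive congruence generated by (w₃, w₄) alone, and (w₃, w₄) is not identified by the additive congruence generated by (w₁, w₂) alone. Let O = {(i,j) : i ∈ {1,2}, j ∈ {3,4}, supp(wᵢ) ∩ supp(w_j) ≠ ∅}. Then the following are equivalent. (1) K[S] = AddMonoidAlgebra K S is an integral domain and is integrally closed (K[S] is a normal domain). (2) All of the following hold: (a) supp(w₁) ∩ supp(w₂) = ∅ and supp(w₃) ∩ supp(w₄) = ∅; (b) Hsupp(w₁) = ∅ or Hsupp(w₂) = ∅; (c) Hsupp(w₃) = ∅ or Hsupp(w₄) = ∅; (d) one of the following three cases holds: O = ∅; or O = {(i,j)} is a singleton and, writing i' for the element of {1,2} other than i and j' for the element of {3,4} other than j, Hsupp(w_{i'}) = ∅ or Hsupp(w_{j'})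 = ∅; or O consists of exactly two pairs which share a common coordinate, and the unique index m ∈ {1,2,3,4} occurring in no pair of O satisfies Hsupp(w_m) = ∅ (note that then supp(w_m) is disjoint from supp(w_p) for all p ≠ m). -/
/-- The support of a word in the free abelian monoid `Fin n →₀ ℕ`. -/
def supp {n : ℕ} (w : Fin n →₀ ℕ) : Set (Fin n) := {i | w i ≠ 0}

/-- `Hsupp w` is the set of generators occurring in `w` with exponent at least `2`;
`w` is square free iff `Hsupp w = ∅`. -/
def Hsupp {n : ℕ} (w : Fin n →₀ ℕ) : Set (Fin n) := {i | 2 ≤ w i}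

/-- The supports of two words intersect nontrivially. -/
def Overlap {n : ℕ} (v w : Fin n →₀ ℕ) : Prop := supp v ∩ supp w ≠ ∅

/-- The two relations `w₁ = w₂` and `w₃ = w₄` are independent: neither is a consequence
of the additive congruence generated by the other alone. -/
def IndependentRels {n : ℕ} (w₁ w₂ w₃ w₄ : Fin n →₀ ℕ) : Prop :=
  ¬ (addConGen fun x y => x = w₃ ∧ y = w₄) w₁ w₂ ∧
  ¬ (addConGen fun x y => x = w₁ ∧ y = w₂) w₃ w₄

/-- Condition (d) of the two-relator normality criterion, with
`O = {(i,j) : i ∈ {1,2}, j ∈ {3,4}, supp(wᵢ) ∩ supp(w_j) ≠ ∅}`: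
either `O = ∅`; or `O` is a singleton `{(i,j)}` and `Hsupp(w_{i'}) = ∅` or
`Hsupp(w_{j'}) = ∅` for the complementary indices `i', j'`; or `O` consists of exactly
two pairs sharing a common coordinate and the unique index `m` occurring in no pair of
`O` satisfies `Hsupp(w_m) = ∅`. -/
def CondD {n : ℕ} (w₁ w₂ w₃ w₄ : Fin n →₀ ℕ) : Prop :=
  -- O = ∅
  (¬ Overlap w₁ w₃ ∧ ¬ Overlap w₁ w₄ ∧ ¬ Overlap w₂ w₃ ∧ ¬ Overlap w₂ w₄) ∨
  -- O = {(i,j)} a singleton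
  (Overlap w₁ w₃ ∧ ¬ Overlap w₁ w₄ ∧ ¬ Overlap w₂ w₃ ∧ ¬ Overlap w₂ w₄ ∧
    (Hsupp w₂ = ∅ ∨ Hsupp w₄ = ∅)) ∨
  (¬ Overlap w₁ w₃ ∧ Overlap w₁ w₄ ∧ ¬ Overlap w₂ w₃ ∧ ¬ Overlap w₂ w₄ ∧
    (Hsupp w₂ = ∅ ∨ Hsupp w₃ = ∅)) ∨
  (¬ Overlap w₁ w₃ ∧ ¬ Overlap w₁ w₄ ∧ Overlap w₂ w₃ ∧ ¬ Overlap w₂ w₄ ∧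
    (Hsupp w₁ = ∅ ∨ Hsupp w₄ = ∅)) ∨
  (¬ Overlap w₁ w₃ ∧ ¬ Overlap w₁ w₄ ∧ ¬ Overlap w₂ w₃ ∧ Overlap w₂ w₄ ∧
    (Hsupp w₁ = ∅ ∨ Hsupp w₃ = ∅)) ∨
  -- O consists of exactly two pairs sharing a common coordinate
  (Overlap w₁ w₃ ∧ Overlap w₁ w₄ ∧ ¬ Overlap w₂ w₃ ∧ ¬ Overlap w₂ w₄ ∧ Hsupp w₂ = ∅) ∨
  (¬ Overlap w₁ w₃ ∧ ¬ Overlap w₁ w₄ ∧ Overlap w₂ w₃ ∧ Overlap w₂ w₄ ∧ Hsupp w₁ = ∅) ∨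
  (Overlap w₁ w₃ ∧ ¬ Overlap w₁ w₄ ∧ Overlap w₂ w₃ ∧ ¬ Overlap w₂ w₄ ∧ Hsupp w₄ = ∅) ∨
  (¬ Overlap w₁ w₃ ∧ Overlap w₁ w₄ ∧ ¬ Overlap w₂ w₃ ∧ Overlap w₂ w₄ ∧ Hsupp w₃ = ∅)

/-- A domain that is a retract, as a module over itself, of an integrally closed overdomain is
integrally closed. -/
theorem isIntegrallyClosed_of_retraction {R A : Type*} [CommRing R] [IsDomain R] [CommRing A]
    [IsDomain A] [IsIntegrallyClosed A] (ι : R →+* A) (hι : Function.Injective ι) (ρ : A → R)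
    (hρ : ∀ r a, ρ (ι r * a) = r * ρ a) (hρ₁ : ρ 1 = 1) : IsIntegrallyClosed R := by
  rw [isIntegrallyClosed_iff (FractionRing R)]
  intro x hx
  let j : FractionRing R →+* FractionRing A := IsFractionRing.map hι
  have hj : ∀ r, j (algebraMap R _ r) = algebraMap A _ (ι r) := fun r => by
    simp [j, IsFractionRing.map]
  have hjx : IsIntegral A (j x) :=
    hx.map_of_comp_eq ι j (RingHom.ext fun r => (hj r).symm)
  obtain ⟨a, ha⟩ := IsIntegrallyClosed.isIntegral_iff.1 hjx
  obtain ⟨f, g, hg, rfl⟩ := IsFractionRing.div_surjective (A := R) x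
  have hg0 : ι g ≠ 0 := by
    rw [Ne, map_eq_zero_iff ι hι]; exact nonZeroDivisors.ne_zero hg
  have hg0' : algebraMap A (FractionRing A) (ι g) ≠ 0 := by
    rw [Ne, map_eq_zero_iff _ (IsFractionRing.injective A (FractionRing A))]; exact hg0
  have hfg : ι f = ι g * a := by
    apply IsFractionRing.injective A (FractionRing A)
    rw [map_div₀, hj, hj, eq_div_iff hg0'] at ha
    rw [map_mul, ← ha, mul_comm]
  have hf : f = g * ρ a := by
    rw [← hρ, ← hfg, ← mul_one (ι f), hρ, hρ₁, mul_one]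
  refine ⟨ρ a, ?_⟩
  have hgR : algebraMap R (FractionRing R) g ≠ 0 := by
    rw [Ne, map_eq_zero_iff _ (IsFractionRing.injective R (FractionRing R))]
    exact nonZeroDivisors.ne_zero hg
  rw [eq_div_iff hgR, ← map_mul, mul_comm, ← hf]

/-- If a commutative monoid embeds in a free abelian monoid compatibly with divisibility, then
its algebra over a field is a normal domain. -/
theorem AddMonoidAlgebra.isDomain_and_isIntegrallyClosed_of_divisor_hom (K : Type*) [Field K]
    {S : Type*} [AddCommMonoid S] {σ : Type*} (φ : S →+ (σ →₀ ℕ)) (hinj : Function.Injective φ)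
    (hdiv : ∀ a b, φ a ≤ φ b → ∃ t, b = a + t) :
    IsDomain (AddMonoidAlgebra K S) ∧ IsIntegrallyClosed (AddMonoidAlgebra K S) := by
  let ι : AddMonoidAlgebra K S →+* MvPolynomial σ K := AddMonoidAlgebra.mapDomainRingHom K φ
  have hι : Function.Injective ι := AddMonoidAlgebra.mapDomain_injective hinj
  have hdom : IsDomain (AddMonoidAlgebra K S) := hι.isDomain ι
  refine ⟨hdom, isIntegrallyClosed_of_retraction ι hι
    (AddMonoidAlgebra.comapDomainAddMonoidHom φ hinj) (fun r a => ?_) ?_⟩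
  · induction r using AddMonoidAlgebra.induction_linear with
    | zero => simp
    | add f g hf hg => rw [map_add, add_mul, map_add, hf, hg, add_mul]
    | single s r =>
      induction a using AddMonoidAlgebra.induction_linear with
      | zero => simp
      | add f g hf hg => rw [mul_add, map_add, hf, hg, map_add, mul_add]
      | single v q =>
        have h₁ : ι (AddMonoidAlgebra.single s r) = AddMonoidAlgebra.single (φ s) r := by
          simp [ι]
        rw [h₁, AddMonoidAlgebra.single_mul_single]
        simp only [AddMonoidAlgebra.comapDomainAddMonoidHom_apply]
        by_cases hv : v ∈ Set.range φ
        · obtain ⟨t, rfl⟩ := hv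
          rw [← map_add, AddMonoidAlgebra.comapDomain_single_map,
            AddMonoidAlgebra.comapDomain_single_map, AddMonoidAlgebra.single_mul_single]
        · have hsv : φ s + v ∉ Set.range φ := by
            rintro ⟨u, hu⟩
            obtain ⟨t, rfl⟩ := hdiv s u (hu ▸ le_self_add)
            rw [map_add] at hu
            exact hv ⟨t, add_left_cancel hu⟩
          have key : ∀ w ∉ Set.range φ, ∀ k : K,
              AddMonoidAlgebra.comapDomain φ hinj (AddMonoidAlgebra.single w k) = 0 :=
            fun w hw k => by ext; simp [hw]
          rw [key _ hsv, key _ hv, mul_zero]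
  · rw [AddMonoidAlgebra.comapDomainAddMonoidHom_apply, MvPolynomial.one_def, ← map_zero φ]
    exact AddMonoidAlgebra.comapDomain_single_map ..

/-- In a monoid whose algebra over a field is a domain, addition is cancellative. -/
theorem AddMonoidAlgebra.add_left_cancel_of_isDomain (K : Type*) [Field K] {S : Type*}
    [AddCommMonoid S] [IsDomain (AddMonoidAlgebra K S)] {u x y : S} (h : u + x = u + y) :
    x = y := by
  have h₁ : AddMonoidAlgebra.single u (1 : K) * AddMonoidAlgebra.single x 1 =
      AddMonoidAlgebra.single u 1 * AddMonoidAlgebra.single y 1 := by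
    simp [AddMonoidAlgebra.single_mul_single, h]
  exact AddMonoidAlgebra.single_left_injective one_ne_zero
    (mul_left_cancel₀ (by simp) h₁)

/-- A monoid whose algebra over a field is a normal domain is closed under halving. -/
theorem AddMonoidAlgebra.exists_eq_add_of_two_nsmul_eq (K : Type*) [Field K] {S : Type*}
    [AddCommMonoid S] [IsDomain (AddMonoidAlgebra K S)]
    [IsIntegrallyClosed (AddMonoidAlgebra K S)] {a b t : S} (h : 2 • a = 2 • b + t) :
    ∃ s, a = b + s := by
  classical
  have h₁ : AddMonoidAlgebra.single b (1 : K) ^ 2 ∣ AddMonoidAlgebra.single a 1 ^ 2 :=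
    ⟨AddMonoidAlgebra.single t 1, by
      simp [AddMonoidAlgebra.single_pow, AddMonoidAlgebra.single_mul_single, h]⟩
  obtain ⟨f, hf⟩ := (IsIntegrallyClosed.pow_dvd_pow_iff two_ne_zero).1 h₁
  have ha : a ∈ (AddMonoidAlgebra.single b (1 : K) * f).coeff.support := by
    rw [← hf]; simp
  obtain ⟨s, -, hs⟩ := Finset.mem_image.1
    (AddMonoidAlgebra.support_coeff_single_mul_subset f 1 b ha)
  exact ⟨s, hs.symm⟩

/-- The functionals `ψ` vanish off `Z`, are invariant under the congruence `c`, which only moves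
coordinates in `Z`, and detect divisibility modulo `c`. -/
structure DetectsDivisibility {n : ℕ} {F : Type} (c : AddCon (Fin n →₀ ℕ)) (Z : Set (Fin n))
    (ψ : F → (Fin n →₀ ℕ) →+ ℕ) : Prop where
  invariant : ∀ x y, c x y → ∀ f, ψ f x = ψ f y
  fixed : ∀ x y, c x y → ∀ i ∉ Z, x i = y i
  vanish : ∀ f, ∀ u : Fin n →₀ ℕ, (∀ i ∈ Z, u i = 0) → ψ f u = 0
  divides : ∀ u v, (∀ f, ψ f u ≤ ψ f v) → (∀ i ∉ Z, u i ≤ v i) → ∃ t, c v (u + t)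
  pos : ∀ i ∈ Z, ∃ f, ψ f (Finsupp.single i 1) ≠ 0

theorem detectsDivisibility_bot {n : ℕ} (Z : Set (Fin n)) :
    DetectsDivisibility (⊥ : AddCon (Fin n →₀ ℕ)) Z
      (fun i : Z => Finsupp.applyAddHom (i : Fin n)) where
  invariant := by rintro x _ rfl _; rfl
  fixed := by rintro x _ rfl _ _; rfl
  vanish i u hu := hu i i.2
  divides u v h₁ h₂ := by
    have huv : u ≤ v := fun i => by
      by_cases hi : i ∈ Z
      · exact h₁ ⟨i, hi⟩
      · exact h₂ i hi
    obtain ⟨t, rfl⟩ := exists_add_of_le huv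
    exact ⟨t, rfl⟩
  pos i hi := ⟨⟨i, hi⟩, by simp⟩

theorem DetectsDivisibility.pos_of_ne_zero {n : ℕ} {F : Type} {c : AddCon (Fin n →₀ ℕ)}
    {Z : Set (Fin n)} {ψ : F → (Fin n →₀ ℕ) →+ ℕ} (h : DetectsDivisibility c Z ψ)
    {w : Fin n →₀ ℕ} {i : Fin n} (hi : i ∈ Z) (hw : w i ≠ 0) : ∃ f, ψ f w ≠ 0 := by
  obtain ⟨f, hf⟩ := h.pos i hi
  have hle : Finsupp.single i 1 ≤ w := by
    rw [Finsupp.single_le_iff]; omega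
  obtain ⟨t, rfl⟩ := exists_add_of_le hle
  exact ⟨f, by rw [map_add]; omega⟩

/-- Adjoining a relation `w = z`, where `z` is a square-free word in new generators. -/
theorem DetectsDivisibility.sup {n : ℕ} {F : Type} {c : AddCon (Fin n →₀ ℕ)}
    {Z : Set (Fin n)} {ψ : F → (Fin n →₀ ℕ) →+ ℕ} (h : DetectsDivisibility c Z ψ)
    {w z : Fin n →₀ ℕ} (hw : ∀ i ∉ Z, w i = 0) (hz : ∀ i ∈ Z, z i = 0) (hz₁ : ∀ i, z i ≤ 1)
    (hw₀ : w ≠ 0) (hz₀ : z ≠ 0) :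
    DetectsDivisibility (c ⊔ addConGen fun x y => x = w ∧ y = z) (Z ∪ {i | z i ≠ 0})
      (fun p : {i // z i ≠ 0} × F =>
        ψ p.2 + (AddMonoidHom.mulLeft (ψ p.2 w)).comp (Finsupp.applyAddHom (p.1 : Fin n))) := by
  have hcle : c ≤ c ⊔ addConGen fun x y => x = w ∧ y = z := le_sup_left
  have hwz : (c ⊔ addConGen fun x y => x = w ∧ y = z) w z :=
    (le_sup_right : _ ≤ c ⊔ addConGen fun x y => x = w ∧ y = z)
      (AddConGen.Rel.of _ _ ⟨rfl, rfl⟩)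
  have hzψ : ∀ f, ψ f z = 0 := fun f => h.vanish f z hz
  set c' := c ⊔ addConGen fun x y => x = w ∧ y = z with hc'
  have hleast : ∀ e : AddCon (Fin n →₀ ℕ), c ≤ e → e w z → c' ≤ e := fun e h₁ h₂ =>
    sup_le h₁ (AddCon.addConGen_le.2 (by rintro _ _ ⟨rfl, rfl⟩; exact h₂))
  obtain ⟨y₀, hy₀⟩ : ∃ i, z i ≠ 0 := by
    by_contra! hcon
    exact hz₀ (Finsupp.ext hcon)
  have hwy : ∀ i, z i ≠ 0 → w i = 0 := fun i hi => hw i fun hiZ => hi (hz i hiZ)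
  refine ⟨fun x y hxy p => ?_, fun x y hxy i hi => ?_, fun p u hu => ?_, fun u v h₁ h₂ => ?_,
    fun i hi => ?_⟩
  · refine hleast (AddCon.ker _) (fun x y hxy => ?_) ?_ hxy
    · rw [AddCon.ker_rel]
      have h₁ := h.invariant x y hxy p.2
      have h₂ := h.fixed x y hxy p.1 fun hp => p.1.2 (hz _ hp)
      simp [h₁, h₂]
    · rw [AddCon.ker_rel]
      have h₁ := hz₁ p.1
      have h₂ := p.1.2
      have h₃ := hwy p.1 h₂
      have h₄ : z p.1 = 1 := by omega
      simp [h₃, h₄, hzψ]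
  · refine hleast (AddCon.ker (Finsupp.applyAddHom i)) (fun x y hxy => ?_) ?_ hxy
    · exact h.fixed x y hxy i fun hiZ => hi (Or.inl hiZ)
    · have h₁ : z i = 0 := by_contra fun hne => hi (Or.inr hne)
      have h₂ : w i = 0 := hw i fun hiZ => hi (Or.inl hiZ)
      change w i = z i
      rw [h₁, h₂]
  · have h₁ := h.vanish p.2 u fun i hi => hu i (Or.inl hi)
    have h₂ := hu p.1 (Or.inr p.1.2)
    simp [h₁, h₂]
  · have hψ : ∀ i, z i ≠ 0 → ∀ f, ψ f u + ψ f w * u i ≤ ψ f v + ψ f w * v i := fun i hi f => by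
      simpa using h₁ (⟨i, hi⟩, f)
    have hne : (Finset.univ.filter fun i => z i ≠ 0).Nonempty := ⟨y₀, by simpa using hy₀⟩
    obtain ⟨i₀, hi₀, hmax⟩ := Finset.exists_max_image _ (fun i => (u i : ℤ) - v i) hne
    simp only [Finset.mem_filter, Finset.mem_univ, true_and] at hi₀ hmax
    rcases le_or_gt (v i₀) (u i₀) with hle | hlt
    · obtain ⟨m, hm⟩ := Nat.exists_eq_add_of_le hle
      obtain ⟨u₁, u₂, hu, hu₁, hu₂⟩ : ∃ u₁ u₂ : Fin n →₀ ℕ, u = u₁ + u₂ ∧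
          (∀ i, z i ≠ 0 → u₁ i = 0) ∧ ∀ i, z i = 0 → u₂ i = 0 := by
        classical
        exact ⟨u.filter fun i => z i = 0, u.filter fun i => ¬ z i = 0,
          (Finsupp.filter_add_filter_not u _).symm, fun i hi => by simp [hi],
          fun i hi => by simp [hi]⟩
      have hui : ∀ i, u i = u₁ i + u₂ i := fun i => by rw [hu]; rfl
      obtain ⟨t, ht⟩ := h.divides (u₁ + m • w) v (fun f => by
        have h₃ := hψ i₀ hi₀ f
        have h₄ : ψ f u = ψ f u₁ := by
          rw [hu, map_add, h.vanish f u₂ fun i hi => hu₂ i (hz i hi), add_zero]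
        rw [h₄, hm] at h₃
        rw [map_add, map_nsmul, smul_eq_mul]
        nlinarith) (fun i hi => by
        have h₃ := hw i hi
        by_cases hzi : z i = 0
        · have h₄ := h₂ i (by simp [hi, hzi])
          have h₅ := hui i
          simp [h₃]; omega
        · simp [h₃, hu₁ i hzi])
      have hle' : u ≤ u₁ + m • z + t := fun i => by
        have h₃ := hui i
        by_cases hzi : z i = 0
        · have h₄ := hu₂ i hzi
          simp [hzi]; omega
        · have h₄ : z i = 1 := by have := hz₁ i; omega
          have h₅ := h.fixed _ _ ht i fun hiZ => hzi (hz i hiZ)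
          have h₆ := hmax i hzi
          have h₇ := hwy i hzi
          have h₈ := hu₁ i hzi
          simp [h₇, h₈] at h₅
          simp [h₄, h₈]
          omega
      obtain ⟨s, hs⟩ := exists_add_of_le hle'
      refine ⟨s, c'.trans (hcle ht) ?_⟩
      rw [← hs]
      exact c'.add (c'.add (c'.refl _) (c'.nsmul m hwz)) (c'.refl _)
    · obtain ⟨k, hk⟩ := Nat.exists_eq_add_of_le hlt.le
      have hle' : k • z ≤ v := fun i => by
        by_cases hzi : z i = 0
        · simp [hzi]
        · have h₄ : z i = 1 := by have := hz₁ i; omega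
          have h₆ := hmax i hzi
          simp [h₄]; omega
      obtain ⟨v₀, rfl⟩ := exists_add_of_le hle'
      obtain ⟨t, ht⟩ := h.divides u (k • w + v₀) (fun f => by
        have h₃ := hψ i₀ hi₀ f
        rw [hk, map_add, map_nsmul, hzψ, smul_zero, zero_add] at h₃
        rw [map_add, map_nsmul, smul_eq_mul]
        nlinarith) (fun i hi => by
        have h₃ := hw i hi
        by_cases hzi : z i = 0
        · have h₄ := h₂ i (by simp [hi, hzi])
          simp [hzi] at h₄
          simpa [h₃] using h₄
        · have h₄ : z i = 1 := by have := hz₁ i; omega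
          have h₆ := hmax i hzi
          simp [h₄] at h₆ hk
          simp [h₃]; omega)
      exact ⟨t, c'.trans (c'.add (c'.nsmul k (c'.symm hwz)) (c'.refl _)) (hcle ht)⟩
  · rcases hi with hi | hi
    · obtain ⟨f, hf⟩ := h.pos i hi
      exact ⟨(⟨y₀, hy₀⟩, f), by simp; omega⟩
    · obtain ⟨j, hj⟩ : ∃ j, w j ≠ 0 := by
        by_contra! hcon
        exact hw₀ (Finsupp.ext hcon)
      have hjZ : j ∈ Z := by_contra fun hjZ => hj (hw j hjZ)
      obtain ⟨f, hf⟩ := h.pos_of_ne_zero hjZ hj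
      exact ⟨(⟨i, hi⟩, f), by simp [hf]⟩

theorem DetectsDivisibility.isDomain_and_isIntegrallyClosed (K : Type*) [Field K] {n : ℕ}
    {F : Type} [Finite F] {c : AddCon (Fin n →₀ ℕ)} {ψ : F → (Fin n →₀ ℕ) →+ ℕ}
    (h : DetectsDivisibility c Set.univ ψ) :
    IsDomain (AddMonoidAlgebra K c.Quotient) ∧
      IsIntegrallyClosed (AddMonoidAlgebra K c.Quotient) := by
  let φ : c.Quotient →+ (F →₀ ℕ) :=
    c.lift ((Finsupp.linearEquivFunOnFinite ℕ ℕ F).symm.toAddMonoidHom.comp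
      (AddMonoidHom.pi ψ)) (fun x y hxy => by
        rw [AddCon.ker_rel]
        ext f
        simpa using h.invariant x y hxy f)
  have hφ : ∀ (u : Fin n →₀ ℕ) f, φ (u : c.Quotient) f = ψ f u := fun u f => rfl
  have hdiv : ∀ a b, φ a ≤ φ b → ∃ t, b = a + t := by
    intro a b
    induction a, b using AddCon.induction_on₂ with
    | H u v =>
      intro hab
      obtain ⟨t, ht⟩ := h.divides u v (fun f => by simpa [hφ] using hab f) (by simp)
      exact ⟨t, by rw [← AddCon.coe_add]; exact (AddCon.eq c).2 ht⟩
  have hker : ∀ a, φ a = 0 → a = 0 := by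
    intro a
    induction a using AddCon.induction_on with
    | H u =>
      intro hu
      have : u = 0 := by
        by_contra hne
        obtain ⟨i, hi⟩ : ∃ i, u i ≠ 0 := by
          by_contra! hcon
          exact hne (Finsupp.ext hcon)
        obtain ⟨f, hf⟩ := h.pos_of_ne_zero (Set.mem_univ i) hi
        exact hf (by rw [← hφ, hu]; rfl)
      rw [this]; rfl
  refine AddMonoidAlgebra.isDomain_and_isIntegrallyClosed_of_divisor_hom K φ
    (fun a b hab => ?_) hdiv
  obtain ⟨t, rfl⟩ := hdiv a b hab.le
  rw [map_add, left_eq_add] at hab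
  rw [hker t hab, add_zero]

theorem isDomain_and_isIntegrallyClosed_of_squarefree (K : Type*) [Field K] {n : ℕ}
    {w₁ w₂ w₃ w₄ : Fin n →₀ ℕ} (h₁ : w₁ ≠ 0) (h₂ : w₂ ≠ 0) (h₃ : w₃ ≠ 0) (h₄ : w₄ ≠ 0)
    (h₁₂ : ∀ i, w₁ i = 0 ∨ w₂ i = 0) (h₂₃ : ∀ i, w₂ i = 0 ∨ w₃ i = 0)
    (h₂₄ : ∀ i, w₂ i = 0 ∨ w₄ i = 0) (h₃₄ : ∀ i, w₃ i = 0 ∨ w₄ i = 0)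
    (hs₂ : ∀ i, w₂ i ≤ 1) (hs₃ : ∀ i, w₃ i ≤ 1) {c : AddCon (Fin n →₀ ℕ)}
    (hr₁ : c w₁ w₂) (hr₃ : c w₃ w₄)
    (hleast : ∀ e : AddCon (Fin n →₀ ℕ), e w₁ w₂ → e w₃ w₄ → c ≤ e) :
    IsDomain (AddMonoidAlgebra K c.Quotient) ∧
      IsIntegrallyClosed (AddMonoidAlgebra K c.Quotient) := by
  have hd := ((detectsDivisibility_bot {i | w₂ i = 0 ∧ w₃ i = 0}).sup (w := w₄) (z := w₃)
    (fun i hi => by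
      have := h₂₄ i; have := h₃₄ i; simp only [Set.mem_ofPred_eq] at hi; omega)
    (fun i hi => hi.2) hs₃ h₄ h₃).sup (w := w₁) (z := w₂)
    (fun i hi => by
      have := h₁₂ i; simp only [Set.mem_union, Set.mem_ofPred_eq] at hi; omega)
    (fun i hi => by
      have := h₂₃ i; simp only [Set.mem_union, Set.mem_ofPred_eq] at hi; omega) hs₂ h₁ h₂
  have hZ : ({i | w₂ i = 0 ∧ w₃ i = 0} ∪ {i | w₃ i ≠ 0}) ∪ {i | w₂ i ≠ 0} = Set.univ := by
    ext i; simp only [Set.mem_union, Set.mem_ofPred_eq, Set.mem_univ, iff_true]; omega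
  have hc : (⊥ ⊔ addConGen fun x y => x = w₄ ∧ y = w₃) ⊔ (addConGen fun x y => x = w₁ ∧ y = w₂)
      = c := by
    refine le_antisymm (sup_le (sup_le bot_le ?_) ?_) (hleast _ ?_ ?_)
    · exact AddCon.addConGen_le.2 (by rintro _ _ ⟨rfl, rfl⟩; exact c.symm hr₃)
    · exact AddCon.addConGen_le.2 (by rintro _ _ ⟨rfl, rfl⟩; exact hr₁)
    · exact (le_sup_right : _ ≤ _ ⊔ addConGen fun x y => x = w₁ ∧ y = w₂)
        (AddConGen.Rel.of _ _ ⟨rfl, rfl⟩)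
    · refine AddCon.symm _ ((le_sup_left : _ ≤ _ ⊔ addConGen fun x y => x = w₁ ∧ y = w₂)
        ((le_sup_right : _ ≤ ⊥ ⊔ addConGen fun x y => x = w₄ ∧ y = w₃)
          (AddConGen.Rel.of _ _ ⟨rfl, rfl⟩)))
  rw [hZ, hc] at hd
  exact hd.isDomain_and_isIntegrallyClosed K

/-- The congruence `c` is generated by the two pairs `(w₁, w₂)` and `(w₃, w₄)` of nonzero words,
neither of which is redundant, and its quotient is cancellative and closed under halving. -/
structure HalvingPresentation {n : ℕ} (c : AddCon (Fin n →₀ ℕ)) (w₁ w₂ w₃ w₄ : Fin n →₀ ℕ) :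
    Prop where
  rel₁ : c w₁ w₂
  rel₃ : c w₃ w₄
  least : ∀ e : AddCon (Fin n →₀ ℕ), e w₁ w₂ → e w₃ w₄ → c ≤ e
  cancel : ∀ u x y, c (u + x) (u + y) → c x y
  halve : ∀ a b t, c (2 • a) (2 • b + t) → ∃ s, c a (b + s)
  indep₁ : ∃ d ≤ c, d w₃ w₄ ∧ ¬ d w₁ w₂
  indep₃ : ∃ d ≤ c, d w₁ w₂ ∧ ¬ d w₃ w₄
  ne₁ : w₁ ≠ 0
  ne₂ : w₂ ≠ 0
  ne₃ : w₃ ≠ 0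
  ne₄ : w₄ ≠ 0

namespace HalvingPresentation

variable {n : ℕ} {c : AddCon (Fin n →₀ ℕ)} {w₁ w₂ w₃ w₄ : Fin n →₀ ℕ}

theorem swap₁₂ (h : HalvingPresentation c w₁ w₂ w₃ w₄) : HalvingPresentation c w₂ w₁ w₃ w₄ where
  rel₁ := c.symm h.rel₁
  rel₃ := h.rel₃
  least e h₁ h₃ := h.least e (e.symm h₁) h₃
  cancel := h.cancel
  halve := h.halve
  indep₁ := h.indep₁.imp fun d hd => ⟨hd.1, hd.2.1, fun h' => hd.2.2 (d.symm h')⟩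
  indep₃ := h.indep₃.imp fun d hd => ⟨hd.1, d.symm hd.2.1, hd.2.2⟩
  ne₁ := h.ne₂
  ne₂ := h.ne₁
  ne₃ := h.ne₃
  ne₄ := h.ne₄

theorem swap (h : HalvingPresentation c w₁ w₂ w₃ w₄) : HalvingPresentation c w₃ w₄ w₁ w₂ where
  rel₁ := h.rel₃
  rel₃ := h.rel₁
  least e h₁ h₃ := h.least e h₃ h₁
  cancel := h.cancel
  halve := h.halve
  indep₁ := h.indep₃
  indep₃ := h.indep₁
  ne₁ := h.ne₃
  ne₂ := h.ne₄
  ne₃ := h.ne₁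
  ne₄ := h.ne₂

theorem swap₃₄ (h : HalvingPresentation c w₁ w₂ w₃ w₄) : HalvingPresentation c w₁ w₂ w₄ w₃ :=
  h.swap.swap₁₂.swap

/-- A set of words stable under both relations is a union of congruence classes. -/
theorem mem_iff (h : HalvingPresentation c w₁ w₂ w₃ w₄) {D : Set (Fin n →₀ ℕ)}
    (h₁ : ∀ t, t + w₁ ∈ D ↔ t + w₂ ∈ D) (h₃ : ∀ t, t + w₃ ∈ D ↔ t + w₄ ∈ D)
    {x y : Fin n →₀ ℕ} (hxy : c x y) : x ∈ D ↔ y ∈ D := by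
  let e : AddCon (Fin n →₀ ℕ) :=
    { r := fun x y => ∀ t, t + x ∈ D ↔ t + y ∈ D
      iseqv := ⟨fun _ _ => Iff.rfl, fun h t => (h t).symm, fun h h' t => (h t).trans (h' t)⟩
      add' := fun {x y z w} h h' t => by
        rw [← add_assoc, h' (t + x), add_right_comm, h (t + w), add_right_comm, add_assoc] }
  simpa using h.least e h₁ h₃ hxy 0

/-- A word containing none of the relators is alone in its class. -/
theorem le_of_ne (h : HalvingPresentation c w₁ w₂ w₃ w₄) {x y : Fin n →₀ ℕ} (hxy : c x y)
    (hne : x ≠ y) : w₁ ≤ x ∨ w₂ ≤ x ∨ w₃ ≤ x ∨ w₄ ≤ x := by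
  by_contra! hcon
  obtain ⟨h₁, h₂, h₃, h₄⟩ := hcon
  have key : ∀ {w}, ¬ w ≤ x → ∀ t, t + w ∉ ({x} : Set (Fin n →₀ ℕ)) := fun hw t ht =>
    hw (le_of_le_of_eq le_add_self ht)
  exact hne.symm ((h.mem_iff (fun t => iff_of_false (key h₁ t) (key h₂ t))
    (fun t => iff_of_false (key h₃ t) (key h₄ t)) hxy).1 rfl)

theorem eq_zero (h : HalvingPresentation c w₁ w₂ w₃ w₄) {x : Fin n →₀ ℕ} (hx : c 0 x) :
    x = 0 := by
  by_contra hne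
  rcases h.le_of_ne hx (Ne.symm hne) with h' | h' | h' | h'
  · exact h.ne₁ (le_zero_iff.1 h')
  · exact h.ne₂ (le_zero_iff.1 h')
  · exact h.ne₃ (le_zero_iff.1 h')
  · exact h.ne₄ (le_zero_iff.1 h')

theorem eq_zero_of_add (h : HalvingPresentation c w₁ w₂ w₃ w₄) {u x : Fin n →₀ ℕ}
    (hx : c u (u + x)) : x = 0 :=
  h.eq_zero (h.cancel u 0 x (by simpa using hx))

/-- Relations between a proper part of `w₁` and other words do not use the relation `w₁ = w₂`. -/
theorem rel_of_proper (h : HalvingPresentation c w₁ w₂ w₃ w₄) {d : AddCon (Fin n →₀ ℕ)}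
    (hd : d ≤ c) (hd₃ : d w₃ w₄) {u v y : Fin n →₀ ℕ} (hv : v ≠ 0) (hw : w₁ = u + v)
    (huy : c u y) : d u y := by
  have key : ∀ t, ¬ c u (t + w₁) := fun t ht => by
    rw [hw, add_left_comm] at ht
    exact hv (add_eq_zero.1 (h.eq_zero_of_add ht)).2
  refine (h.mem_iff (D := {x | d u x}) (fun t => iff_of_false (fun ht => key t (hd ht))
    fun ht => key t (c.trans (hd ht) (c.add (c.refl t) (c.symm h.rel₁)))) (fun t => ?_) huy).1
    (d.refl u)
  exact ⟨fun ht => d.trans ht (d.add (d.refl t) hd₃),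
    fun ht => d.trans ht (d.add (d.refl t) (d.symm hd₃))⟩

theorem disjoint₁₂ (h : HalvingPresentation c w₁ w₂ w₃ w₄) (i : Fin n) :
    w₁ i = 0 ∨ w₂ i = 0 := by
  by_contra! hcon
  obtain ⟨d, hd, hd₃, hd₁⟩ := h.indep₁
  obtain ⟨v₁, h₁⟩ := exists_add_of_le (show Finsupp.single i 1 ≤ w₁ by
    rw [Finsupp.single_le_iff]; omega)
  obtain ⟨v₂, h₂⟩ := exists_add_of_le (show Finsupp.single i 1 ≤ w₂ by
    rw [Finsupp.single_le_iff]; omega)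
  have hv : c v₁ v₂ := h.cancel (Finsupp.single i 1) _ _ (by rw [← h₁, ← h₂]; exact h.rel₁)
  have := h.rel_of_proper hd hd₃ (by simp) (h₁.trans (add_comm _ _)) hv
  exact hd₁ (by rw [h₁, h₂]; exact d.add (d.refl _) this)

theorem disjoint₃₄ (h : HalvingPresentation c w₁ w₂ w₃ w₄) : ∀ i, w₃ i = 0 ∨ w₄ i = 0 :=
  h.swap.disjoint₁₂

theorem not_le (h : HalvingPresentation c w₁ w₂ w₃ w₄) (h₃₁ : w₃ ≤ w₁) (h₄₂ : w₄ ≤ w₂) :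
    False := by
  obtain ⟨d, hd, hd₃, hd₁⟩ := h.indep₁
  obtain ⟨r, hr⟩ := exists_add_of_le h₃₁
  obtain ⟨r', hr'⟩ := exists_add_of_le h₄₂
  have hc : c (w₃ + r) (w₃ + r') := by
    rw [← hr]
    refine c.trans h.rel₁ ?_
    rw [hr']
    exact c.add (c.symm h.rel₃) (c.refl _)
  have := h.rel_of_proper hd hd₃ h.ne₃ (hr.trans (add_comm _ _)) (h.cancel _ _ _ hc)
  exact hd₁ (by rw [hr, hr']; exact d.add hd₃ this)

theorem exists_ne_zero {w : Fin n →₀ ℕ} (hw : w ≠ 0) : ∃ i, w i ≠ 0 := by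
  by_contra! hcon
  exact hw (Finsupp.ext hcon)

theorem not_le_of_disjoint {v w u : Fin n →₀ ℕ} (hv : v ≠ 0) (hvw : ∀ i, v i = 0 ∨ w i = 0)
    (hu : u ≤ w) : ¬ v ≤ u := fun hvu => by
  obtain ⟨i, hi⟩ := exists_ne_zero hv
  have h₁ := hvw i
  have h₂ := hu i
  have h₃ := hvu i
  omega

theorem le_of_not_squarefree (h : HalvingPresentation c w₁ w₂ w₃ w₄) {i j : Fin n}
    (hi : 2 ≤ w₁ i) (hj : 2 ≤ w₂ j) : w₃ ≤ w₁ ∨ w₄ ≤ w₁ := by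
  obtain ⟨a, ha⟩ := exists_add_of_le (show Finsupp.single i 2 ≤ w₁ by
    rwa [Finsupp.single_le_iff])
  obtain ⟨b, hb⟩ := exists_add_of_le (show Finsupp.single j 2 ≤ w₂ by
    rwa [Finsupp.single_le_iff])
  have h2 : ∀ k : Fin n, Finsupp.single k 2 = Finsupp.single k 1 + Finsupp.single k 1 := fun k => by
    rw [← Finsupp.single_add]
  have hw : w₁ = (Finsupp.single i 1 + a) + Finsupp.single i 1 := by
    rw [ha, h2]; abel
  obtain ⟨s, hs⟩ := h.halve (Finsupp.single i 1 + a) (Finsupp.single j 1) (b + a) (by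
    have e₁ : 2 • (Finsupp.single i 1 + a) = w₁ + a := by rw [hw]; abel
    have e₂ : 2 • Finsupp.single j 1 + (b + a) = w₂ + a := by rw [hb, h2]; abel
    rw [e₁, e₂]
    exact c.add h.rel₁ (c.refl _))
  have hle : Finsupp.single i 1 + a ≤ w₁ := by rw [hw]; exact le_self_add
  have hne : Finsupp.single i 1 + a ≠ Finsupp.single j 1 + s := fun heq => by
    have h₁ := hle j
    rw [heq] at h₁
    have h₂ := h.disjoint₁₂ j
    simp at h₁
    omega
  rcases h.le_of_ne hs hne with h' | h' | h' | h'
  · have := h' i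
    rw [hw] at this
    simp at this
  · exact absurd h' (not_le_of_disjoint h.ne₂ (fun i => (h.disjoint₁₂ i).symm) hle)
  · exact Or.inl (h'.trans hle)
  · exact Or.inr (h'.trans hle)

theorem squarefree₁₂ (h : HalvingPresentation c w₁ w₂ w₃ w₄) :
    (∀ i, w₁ i ≤ 1) ∨ ∀ i, w₂ i ≤ 1 := by
  by_contra! hcon
  obtain ⟨⟨i, hi⟩, j, hj⟩ := hcon
  have key : ∀ {w : Fin n →₀ ℕ}, w ≠ 0 → w ≤ w₁ → ¬ w ≤ w₂ := fun hw h₁ =>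
    not_le_of_disjoint hw (fun i => by have := h₁ i; have := h.disjoint₁₂ i; omega) le_rfl
  rcases h.le_of_not_squarefree hi hj with h₁ | h₁ <;>
    rcases h.swap₁₂.le_of_not_squarefree hj hi with h₂ | h₂
  · exact key h.ne₃ h₁ h₂
  · exact h.not_le h₁ h₂
  · exact h.swap₃₄.not_le h₁ h₂
  · exact key h.ne₄ h₁ h₂

theorem squarefree₃₄ (h : HalvingPresentation c w₁ w₂ w₃ w₄) :
    (∀ i, w₃ i ≤ 1) ∨ ∀ i, w₄ i ≤ 1 := h.swap.squarefree₁₂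

theorem exists_inf_add (v w : Fin n →₀ ℕ) : ∃ x a b : Fin n →₀ ℕ, v = x + a ∧ w = x + b ∧
    ∀ i, a i = 0 ∨ b i = 0 := by
  obtain ⟨a, ha⟩ := exists_add_of_le (inf_le_left : v ⊓ w ≤ v)
  obtain ⟨b, hb⟩ := exists_add_of_le (inf_le_right : v ⊓ w ≤ w)
  refine ⟨v ⊓ w, a, b, ha, hb, fun i => ?_⟩
  have h₁ := DFunLike.congr_fun ha i
  have h₂ := DFunLike.congr_fun hb i
  simp only [Finsupp.add_apply, Finsupp.inf_apply] at h₁ h₂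
  omega

/-- The overlaps of the two relations contain no perfect matching. -/
theorem not_matching (h : HalvingPresentation c w₁ w₂ w₃ w₄) {i j : Fin n}
    (hi₁ : w₁ i ≠ 0) (hi₃ : w₃ i ≠ 0) (hj₂ : w₂ j ≠ 0) (hj₄ : w₄ j ≠ 0) : False := by
  obtain ⟨x, a, b, ha, hb, hab⟩ := exists_inf_add w₁ w₃
  obtain ⟨y, e, f, he, hf, hef⟩ := exists_inf_add w₂ w₄
  have hd₁₂ := h.disjoint₁₂
  have hd₃₄ := h.disjoint₃₄
  have ha' : ∀ k, w₁ k = x k + a k := fun k => by rw [ha]; rfl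
  have hb' : ∀ k, w₃ k = x k + b k := fun k => by rw [hb]; rfl
  have he' : ∀ k, w₂ k = y k + e k := fun k => by rw [he]; rfl
  have hf' : ∀ k, w₄ k = y k + f k := fun k => by rw [hf]; rfl
  have hxi : x i ≠ 0 := by have := hab i; have := ha' i; have := hb' i; omega
  have hyj : y j ≠ 0 := by have := hef j; have := he' j; have := hf' j; omega
  have hc : c (a + f) (b + e) := by
    refine h.cancel (x + y) _ _ ?_
    have e₁ : x + y + (a + f) = w₁ + w₄ := by rw [ha, hf]; abel
    have e₂ : x + y + (b + e) = w₂ + w₃ := by rw [hb, he]; abel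
    rw [e₁, e₂]
    exact c.add h.rel₁ (c.symm h.rel₃)
  have zero : ∀ {u v : Fin n →₀ ℕ}, (∀ k, u k ≤ v k) → (∀ k, u k = 0 ∨ v k = 0) → u = 0 :=
    fun hle hdis => Finsupp.ext fun k => by
      have := hle k; have := hdis k; simp only [Finsupp.coe_zero, Pi.zero_apply]; omega
  by_cases heq : a + f = b + e
  · have heq' : ∀ k, a k + f k = b k + e k := fun k => DFunLike.congr_fun heq k
    have hall : ∀ k, a k = 0 ∧ f k = 0 ∧ b k = 0 ∧ e k = 0 := fun k => by
      have := heq' k; have := hab k; have := hef k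
      have := hd₁₂ k; have := hd₃₄ k; have := ha' k; have := hb' k; have := he' k; have := hf' k
      omega
    refine h.not_le (fun k => ?_) (fun k => ?_)
    · have := hall k; have := ha' k; have := hb' k; omega
    · have := hall k; have := he' k; have := hf' k; omega
  have hl : (e = 0 ∧ f j ≠ 0) ∨ (b = 0 ∧ a i ≠ 0) := by
    rcases h.le_of_ne hc heq with h' | h' | h' | h'
    · have := h' i; have := ha' i; have := hf' i; have := hd₃₄ i
      simp only [Finsupp.add_apply] at *; omega
    · refine Or.inl ⟨zero (v := a + f) (fun k => ?_) fun k => ?_, ?_⟩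
      · have := h' k; have := he' k; omega
      · have := hef k; have := hd₁₂ k; have := ha' k; have := he' k
        simp only [Finsupp.add_apply]; omega
      · have := h' j; have := he' j; have := ha' j; have := hd₁₂ j
        simp only [Finsupp.add_apply] at *; omega
    · refine Or.inr ⟨zero (v := a + f) (fun k => ?_) fun k => ?_, ?_⟩
      · have := h' k; have := hb' k; omega
      · have := hab k; have := hd₃₄ k; have := hb' k; have := hf' k
        simp only [Finsupp.add_apply]; omega
      · have := h' i; have := hb' i; have := hf' i; have := hd₃₄ i
        simp only [Finsupp.add_apply] at *; omega
    · have := h' j; have := hf' j; have := ha' j; have := hd₁₂ j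
      simp only [Finsupp.add_apply] at *; omega
  have hr : (a = 0 ∧ b i ≠ 0) ∨ (f = 0 ∧ e j ≠ 0) := by
    rcases h.le_of_ne (c.symm hc) (Ne.symm heq) with h' | h' | h' | h'
    · refine Or.inl ⟨zero (v := b + e) (fun k => ?_) fun k => ?_, ?_⟩
      · have := h' k; have := ha' k; omega
      · have := hab k; have := hd₁₂ k; have := ha' k; have := he' k
        simp only [Finsupp.add_apply]; omega
      · have := h' i; have := ha' i; have := he' i; have := hd₁₂ i
        simp only [Finsupp.add_apply] at *; omega
    · have := h' j; have := he' j; have := hb' j; have := hd₃₄ j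
      simp only [Finsupp.add_apply] at *; omega
    · have := h' i; have := hb' i; have := he' i; have := hd₁₂ i
      simp only [Finsupp.add_apply] at *; omega
    · refine Or.inr ⟨zero (v := b + e) (fun k => ?_) fun k => ?_, ?_⟩
      · have := h' k; have := hf' k; omega
      · have := hef k; have := hd₃₄ k; have := hb' k; have := hf' k
        simp only [Finsupp.add_apply]; omega
      · have := h' j; have := hf' j; have := hb' j; have := hd₃₄ j
        simp only [Finsupp.add_apply] at *; omega
  rcases hl with ⟨rfl, hl⟩ | ⟨rfl, hl⟩ <;> rcases hr with ⟨rfl, hr⟩ | ⟨rfl, hr⟩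
  · refine h.swap.not_le ?_ ?_
    · rw [ha, hb, add_zero]; exact le_self_add
    · rw [he, hf, add_zero]; exact le_self_add
  · exact hl rfl
  · exact hl rfl
  · refine h.not_le ?_ ?_
    · rw [ha, hb, add_zero]; exact le_self_add
    · rw [he, hf, add_zero]; exact le_self_add

theorem single_two_add {p : Fin n} {w : Fin n →₀ ℕ} (hp : 2 ≤ w p) :
    ∃ v, w = 2 • Finsupp.single p 1 + v := by
  obtain ⟨v, hv⟩ := exists_add_of_le (show Finsupp.single p 2 ≤ w by
    rwa [Finsupp.single_le_iff])
  exact ⟨v, by simpa using hv⟩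

/-- If only `w₁` and `w₃` overlap, then `w₂` or `w₄` is square free. -/
theorem squarefree₂₄ (h : HalvingPresentation c w₁ w₂ w₃ w₄) {i : Fin n} (hi₁ : w₁ i ≠ 0)
    (hi₃ : w₃ i ≠ 0) (h₁₄ : ∀ k, w₁ k = 0 ∨ w₄ k = 0) (h₂₃ : ∀ k, w₂ k = 0 ∨ w₃ k = 0)
    (h₂₄ : ∀ k, w₂ k = 0 ∨ w₄ k = 0) : (∀ k, w₂ k ≤ 1) ∨ ∀ k, w₄ k ≤ 1 := by
  by_contra! hcon
  obtain ⟨⟨p, hp⟩, q, hq⟩ := hcon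
  have hs₁ : ∀ k, w₁ k ≤ 1 := h.squarefree₁₂.resolve_right fun h' => by have := h' p; omega
  have hs₃ : ∀ k, w₃ k ≤ 1 := h.squarefree₃₄.resolve_right fun h' => by have := h' q; omega
  have hd₁₂ := h.disjoint₁₂
  have hd₃₄ := h.disjoint₃₄
  obtain ⟨x, a, b, ha, hb, hab⟩ := exists_inf_add w₁ w₃
  obtain ⟨v, hv⟩ := single_two_add hp
  obtain ⟨v', hv'⟩ := single_two_add hq
  have ha' : ∀ k, w₁ k = x k + a k := fun k => by rw [ha]; rfl
  have hb' : ∀ k, w₃ k = x k + b k := fun k => by rw [hb]; rfl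
  have hxab : x + a + b = b + w₁ := by rw [ha]; abel
  have hxba : x + a + b = a + w₃ := by rw [hb]; abel
  obtain ⟨s, hs⟩ := h.halve (x + a + b) (Finsupp.single p 1 + Finsupp.single q 1)
    (v + v' + (a + b)) (by
      have e₁ : 2 • (x + a + b) = w₁ + w₃ + (a + b) := by rw [ha, hb]; abel
      have e₂ : 2 • (Finsupp.single p 1 + Finsupp.single q 1) + (v + v' + (a + b)) =
        w₂ + w₄ + (a + b) := by rw [hv, hv']; abel
      rw [e₁, e₂]
      exact c.add (c.add h.rel₁ h.rel₃) (c.refl _))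
  have i₁ := ha' i
  have i₂ := hb' i
  have i₃ := hab i
  have i₄ := hs₁ i
  have i₅ := hs₃ i
  have i₆ := hd₁₂ i
  have i₇ := hd₃₄ i
  have p₁ := ha' p
  have p₂ := hb' p
  have p₃ := hd₁₂ p
  have p₄ := h₂₃ p
  have p₅ := h₂₄ p
  have q₁ := ha' q
  have q₂ := hb' q
  have q₃ := hd₃₄ q
  have q₄ := h₁₄ q
  have q₅ := h₂₄ q
  have hmem := (h.mem_iff (D := {x + a + b, b + w₂, a + w₄}) (fun t => ?_) (fun t => ?_) hs).1
    (Or.inl rfl)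
  · rcases hmem with h' | h' | h'
    · have := DFunLike.congr_fun h' p
      simp at this; omega
    · have := DFunLike.congr_fun h' q
      simp at this; omega
    · have := DFunLike.congr_fun h' p
      simp at this; omega
  · constructor
    · rintro (h' | h' | h')
      · rw [hxab] at h'
        exact Or.inr (Or.inl (by rw [add_right_cancel h']))
      · have := DFunLike.congr_fun h' i
        simp at this; omega
      · have := DFunLike.congr_fun h' i
        simp at this; omega
    · rintro (h' | h' | h')
      · have := DFunLike.congr_fun h' p
        simp at this; omega
      · exact Or.inl (by rw [hxab, add_right_cancel h'])
      · have := DFunLike.congr_fun h' p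
        simp at this; omega
  · constructor
    · rintro (h' | h' | h')
      · rw [hxba] at h'
        exact Or.inr (Or.inr (by rw [add_right_cancel h']; rfl))
      · have := DFunLike.congr_fun h' i
        simp at this; omega
      · have := DFunLike.congr_fun h' i
        simp at this; omega
    · rintro (h' | h' | h')
      · have := DFunLike.congr_fun h' q
        simp at this; omega
      · have := DFunLike.congr_fun h' q
        simp at this; omega
      · exact Or.inl (by rw [hxba, add_right_cancel h'])

/-- If `w₁` overlaps both `w₃` and `w₄` while `w₂` overlaps neither, then `w₂` is square free. -/
theorem squarefree₂ (h : HalvingPresentation c w₁ w₂ w₃ w₄) {i j : Fin n} (hi₁ : w₁ i ≠ 0)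
    (hi₃ : w₃ i ≠ 0) (hj₁ : w₁ j ≠ 0) (hj₄ : w₄ j ≠ 0) (h₂₃ : ∀ k, w₂ k = 0 ∨ w₃ k = 0)
    (h₂₄ : ∀ k, w₂ k = 0 ∨ w₄ k = 0) (p : Fin n) : w₂ p ≤ 1 := by
  by_contra! hp
  have hs₁ : ∀ k, w₁ k ≤ 1 := h.squarefree₁₂.resolve_right fun h' => by have := h' p; omega
  have hd₁₂ := h.disjoint₁₂
  have hd₃₄ := h.disjoint₃₄
  obtain ⟨b, hb⟩ := exists_add_of_le (inf_le_right : w₁ ⊓ w₃ ≤ w₃)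
  obtain ⟨d, hd⟩ := exists_add_of_le (inf_le_right : w₁ ⊓ w₄ ≤ w₄)
  obtain ⟨a, ha⟩ := exists_add_of_le (show w₁ ⊓ w₃ + w₁ ⊓ w₄ ≤ w₁ from fun k => by
    have := hd₃₄ k
    simp only [Finsupp.add_apply, Finsupp.inf_apply]
    omega)
  have ha' : ∀ k, w₁ k = min (w₁ k) (w₃ k) + min (w₁ k) (w₄ k) + a k := fun k =>
    DFunLike.congr_fun ha k
  obtain ⟨v, hv⟩ := single_two_add hp
  obtain ⟨s, hs⟩ := h.halve (a + w₄) (Finsupp.single p 1) (v + (a + b + d)) (by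
    have e₁ : 2 • (a + w₄) = a + a + (w₁ ⊓ w₄ + d) + w₄ := by rw [← hd]; abel
    have e₂ : a + a + (w₁ ⊓ w₄ + d) + w₃ = w₁ + (a + b + d) := by
      conv_rhs => rw [ha]
      conv_lhs => rw [hb]
      abel
    have e₃ : 2 • Finsupp.single p 1 + (v + (a + b + d)) = w₂ + (a + b + d) := by
      rw [hv]; abel
    rw [e₁, e₃]
    refine c.trans (c.add (c.refl _) (c.symm h.rel₃)) ?_
    rw [e₂]
    exact c.add h.rel₁ (c.refl _))
  have i₁ := ha' i
  have i₂ := hs₁ i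
  have i₃ := hd₃₄ i
  have j₁ := ha' j
  have j₂ := hs₁ j
  have j₃ := hd₃₄ j
  have p₁ := ha' p
  have p₂ := hd₁₂ p
  have p₃ := h₂₃ p
  have p₄ := h₂₄ p
  have hmem := (h.mem_iff (D := {a + w₄, a + w₃}) (fun t => iff_of_false ?_ ?_) (fun t => ?_)
    hs).1 (Or.inl rfl)
  · rcases hmem with h' | h' <;>
    · have := DFunLike.congr_fun h' p
      simp at this; omega
  · rintro (h' | h')
    · have := DFunLike.congr_fun h' i
      simp at this; omega
    · have := DFunLike.congr_fun h' j
      simp at this; omega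
  · rintro (h' | h') <;>
    · have := DFunLike.congr_fun h' p
      simp at this; omega
  · constructor
    · rintro (h' | h')
      · have := DFunLike.congr_fun h' i
        simp at this; omega
      · exact Or.inl (by rw [add_right_cancel h'])
    · rintro (h' | h')
      · exact Or.inr (by rw [add_right_cancel h']; rfl)
      · have := DFunLike.congr_fun h' j
        simp at this; omega

end HalvingPresentation

theorem supp_inter_supp_eq_empty_iff {n : ℕ} {v w : Fin n →₀ ℕ} :
    supp v ∩ supp w = ∅ ↔ ∀ i, v i = 0 ∨ w i = 0 := by
  simp only [Set.eq_empty_iff_forall_notMem, supp, Set.mem_inter_iff, Set.mem_ofPred_eq]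
  exact forall_congr' fun i => by omega

theorem overlap_iff {n : ℕ} {v w : Fin n →₀ ℕ} : Overlap v w ↔ ∃ i, v i ≠ 0 ∧ w i ≠ 0 := by
  rw [Overlap, Ne, supp_inter_supp_eq_empty_iff]
  push Not
  rfl

theorem not_overlap_iff {n : ℕ} {v w : Fin n →₀ ℕ} :
    ¬ Overlap v w ↔ ∀ i, v i = 0 ∨ w i = 0 := by
  rw [Overlap, not_not, supp_inter_supp_eq_empty_iff]

theorem Hsupp_eq_empty_iff {n : ℕ} {w : Fin n →₀ ℕ} : Hsupp w = ∅ ↔ ∀ i, w i ≤ 1 := by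
  simp only [Set.eq_empty_iff_forall_notMem, Hsupp, Set.mem_ofPred_eq]
  exact forall_congr' fun i => by omega

theorem HalvingPresentation.condD {n : ℕ} {c : AddCon (Fin n →₀ ℕ)} {w₁ w₂ w₃ w₄ : Fin n →₀ ℕ}
    (h : HalvingPresentation c w₁ w₂ w₃ w₄) : CondD w₁ w₂ w₃ w₄ := by
  have sym : ∀ {v w : Fin n →₀ ℕ}, (∀ i, v i = 0 ∨ w i = 0) → ∀ i, w i = 0 ∨ v i = 0 :=
    fun h i => (h i).symm
  have hm : ¬ (Overlap w₁ w₃ ∧ Overlap w₂ w₄) := by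
    rw [overlap_iff, overlap_iff]
    rintro ⟨⟨i, hi⟩, j, hj⟩
    exact h.not_matching hi.1 hi.2 hj.1 hj.2
  have hm' : ¬ (Overlap w₁ w₄ ∧ Overlap w₂ w₃) := by
    rw [overlap_iff, overlap_iff]
    rintro ⟨⟨i, hi⟩, j, hj⟩
    exact h.swap₃₄.not_matching hi.1 hi.2 hj.1 hj.2
  unfold CondD
  by_cases h₁₃ : Overlap w₁ w₃ <;> by_cases h₁₄ : Overlap w₁ w₄ <;>
    by_cases h₂₃ : Overlap w₂ w₃ <;> by_cases h₂₄ : Overlap w₂ w₄ <;>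
    simp only [h₁₃, h₁₄, h₂₃, h₂₄, not_true_eq_false, not_false_eq_true, and_true, true_and,
      and_false, false_and, or_false, false_or, Hsupp_eq_empty_iff] at hm hm' ⊢ <;>
    simp only [not_overlap_iff] at h₁₃ h₁₄ h₂₃ h₂₄ <;>
    simp only [overlap_iff] at h₁₃ h₁₄ h₂₃ h₂₄
  · obtain ⟨i, hi₁, hi₃⟩ := h₁₃
    obtain ⟨j, hj₁, hj₄⟩ := h₁₄
    exact h.squarefree₂ hi₁ hi₃ hj₁ hj₄ h₂₃ h₂₄
  · obtain ⟨i, hi₁, hi₃⟩ := h₁₃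
    obtain ⟨j, hj₂, hj₃⟩ := h₂₃
    exact h.swap.squarefree₂ hi₃ hi₁ hj₃ hj₂ (sym h₁₄) (sym h₂₄)
  · obtain ⟨i, hi₁, hi₃⟩ := h₁₃
    exact h.squarefree₂₄ hi₁ hi₃ h₁₄ h₂₃ h₂₄
  · obtain ⟨i, hi₁, hi₄⟩ := h₁₄
    obtain ⟨j, hj₂, hj₄⟩ := h₂₄
    exact h.swap₃₄.swap.squarefree₂ hi₄ hi₁ hj₄ hj₂ (sym h₁₃) (sym h₂₃)
  · obtain ⟨i, hi₁, hi₄⟩ := h₁₄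
    exact h.swap₃₄.squarefree₂₄ hi₁ hi₄ h₁₃ h₂₄ h₂₃
  · obtain ⟨i, hi₂, hi₃⟩ := h₂₃
    obtain ⟨j, hj₂, hj₄⟩ := h₂₄
    exact h.swap₁₂.squarefree₂ hi₂ hi₃ hj₂ hj₄ h₁₃ h₁₄
  · obtain ⟨i, hi₂, hi₃⟩ := h₂₃
    exact h.swap₁₂.squarefree₂₄ hi₂ hi₃ h₂₄ h₁₃ h₁₄
  · obtain ⟨i, hi₂, hi₄⟩ := h₂₄
    exact h.swap₁₂.swap₃₄.squarefree₂₄ hi₂ hi₄ h₂₃ h₁₄ h₁₃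

theorem stmt7 (K : Type*) [Field K] (n : ℕ) (hn : 1 ≤ n)
    (w₁ w₂ w₃ w₄ : Fin n →₀ ℕ)
    (h₁ : w₁ ≠ 0) (h₂ : w₂ ≠ 0) (h₃ : w₃ ≠ 0) (h₄ : w₄ ≠ 0)
    (hind : IndependentRels w₁ w₂ w₃ w₄)
    (c : AddCon (Fin n →₀ ℕ))
    (hc : c = addConGen (fun x y => (x = w₁ ∧ y = w₂) ∨ (x = w₃ ∧ y = w₄))) :
    (IsDomain (AddMonoidAlgebra K c.Quotient) ∧
        IsIntegrallyClosed (AddMonoidAlgebra K c.Quotient)) ↔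
      ((supp w₁ ∩ supp w₂ = ∅ ∧ supp w₃ ∩ supp w₄ = ∅) ∧
        (Hsupp w₁ = ∅ ∨ Hsupp w₂ = ∅) ∧
        (Hsupp w₃ = ∅ ∨ Hsupp w₄ = ∅) ∧
        CondD w₁ w₂ w₃ w₄) := by
  have hr₁ : c w₁ w₂ := hc ▸ AddConGen.Rel.of _ _ (Or.inl ⟨rfl, rfl⟩)
  have hr₃ : c w₃ w₄ := hc ▸ AddConGen.Rel.of _ _ (Or.inr ⟨rfl, rfl⟩)
  have hleast : ∀ e : AddCon (Fin n →₀ ℕ), e w₁ w₂ → e w₃ w₄ → c ≤ e := fun e he₁ he₃ => by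
    rw [hc, AddCon.addConGen_le]
    rintro _ _ (⟨rfl, rfl⟩ | ⟨rfl, rfl⟩)
    exacts [he₁, he₃]
  constructor
  · rintro ⟨hdom, hcl⟩
    have h : HalvingPresentation c w₁ w₂ w₃ w₄ :=
      { rel₁ := hr₁
        rel₃ := hr₃
        least := hleast
        cancel := fun u x y huxy => (AddCon.eq c).1
          (AddMonoidAlgebra.add_left_cancel_of_isDomain K (u := (u : c.Quotient))
            ((AddCon.eq c).2 huxy))
        halve := fun a b t hab => by
          obtain ⟨s, hs⟩ := AddMonoidAlgebra.exists_eq_add_of_two_nsmul_eq K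
            (a := (a : c.Quotient)) (b := b) (t := t) ((AddCon.eq c).2 hab)
          induction s using AddCon.induction_on with
          | H s => exact ⟨s, (AddCon.eq c).1 hs⟩
        indep₁ := ⟨_, AddCon.addConGen_le.2 (by rintro _ _ ⟨rfl, rfl⟩; exact hr₃),
          AddConGen.Rel.of _ _ ⟨rfl, rfl⟩, hind.1⟩
        indep₃ := ⟨_, AddCon.addConGen_le.2 (by rintro _ _ ⟨rfl, rfl⟩; exact hr₁),
          AddConGen.Rel.of _ _ ⟨rfl, rfl⟩, hind.2⟩
        ne₁ := h₁
        ne₂ := h₂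
        ne₃ := h₃
        ne₄ := h₄ }
    simp only [supp_inter_supp_eq_empty_iff, Hsupp_eq_empty_iff]
    exact ⟨⟨h.disjoint₁₂, h.disjoint₃₄⟩, h.squarefree₁₂, h.squarefree₃₄, h.condD⟩
  · rintro ⟨⟨hd₁₂, hd₃₄⟩, hs₁₂, hs₃₄, hD⟩
    unfold CondD at hD
    simp only [supp_inter_supp_eq_empty_iff, Hsupp_eq_empty_iff, not_overlap_iff]
      at hd₁₂ hd₃₄ hs₁₂ hs₃₄ hD
    have sym : ∀ {v w : Fin n →₀ ℕ}, (∀ i, v i = 0 ∨ w i = 0) → ∀ i, w i = 0 ∨ v i = 0 :=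
      fun h i => (h i).symm
    have of₂ : (∀ i, w₂ i ≤ 1) → (∀ i, w₂ i = 0 ∨ w₃ i = 0) → (∀ i, w₂ i = 0 ∨ w₄ i = 0) →
        IsDomain (AddMonoidAlgebra K c.Quotient) ∧
          IsIntegrallyClosed (AddMonoidAlgebra K c.Quotient) := fun hs h₂₃ h₂₄ =>
      hs₃₄.elim
        (fun hs' => isDomain_and_isIntegrallyClosed_of_squarefree K h₁ h₂ h₃ h₄ hd₁₂ h₂₃ h₂₄ hd₃₄
          hs hs' hr₁ hr₃ hleast)
        (fun hs' => isDomain_and_isIntegrallyClosed_of_squarefree K h₁ h₂ h₄ h₃ hd₁₂ h₂₄ h₂₃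
          (sym hd₃₄) hs hs' hr₁ (c.symm hr₃) fun e he he' => hleast e he (e.symm he'))
    have of₁ : (∀ i, w₁ i ≤ 1) → (∀ i, w₁ i = 0 ∨ w₃ i = 0) → (∀ i, w₁ i = 0 ∨ w₄ i = 0) →
        IsDomain (AddMonoidAlgebra K c.Quotient) ∧
          IsIntegrallyClosed (AddMonoidAlgebra K c.Quotient) := fun hs h₁₃ h₁₄ =>
      hs₃₄.elim
        (fun hs' => isDomain_and_isIntegrallyClosed_of_squarefree K h₂ h₁ h₃ h₄ (sym hd₁₂) h₁₃
          h₁₄ hd₃₄ hs hs' (c.symm hr₁) hr₃ fun e he he' => hleast e (e.symm he) he')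
        (fun hs' => isDomain_and_isIntegrallyClosed_of_squarefree K h₂ h₁ h₄ h₃ (sym hd₁₂) h₁₄
          h₁₃ (sym hd₃₄) hs hs' (c.symm hr₁) (c.symm hr₃)
          fun e he he' => hleast e (e.symm he) (e.symm he'))
    have of₄ : (∀ i, w₄ i ≤ 1) → (∀ i, w₁ i = 0 ∨ w₄ i = 0) → (∀ i, w₂ i = 0 ∨ w₄ i = 0) →
        IsDomain (AddMonoidAlgebra K c.Quotient) ∧
          IsIntegrallyClosed (AddMonoidAlgebra K c.Quotient) := fun hs h₁₄ h₂₄ =>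
      hs₁₂.elim
        (fun hs' => isDomain_and_isIntegrallyClosed_of_squarefree K h₃ h₄ h₁ h₂ hd₃₄ (sym h₁₄)
          (sym h₂₄) hd₁₂ hs hs' hr₃ hr₁ fun e he he' => hleast e he' he)
        (fun hs' => isDomain_and_isIntegrallyClosed_of_squarefree K h₃ h₄ h₂ h₁ hd₃₄ (sym h₂₄)
          (sym h₁₄) (sym hd₁₂) hs hs' hr₃ (c.symm hr₁)
          fun e he he' => hleast e (e.symm he') he)
    have of₃ : (∀ i, w₃ i ≤ 1) → (∀ i, w₁ i = 0 ∨ w₃ i = 0) → (∀ i, w₂ i = 0 ∨ w₃ i = 0) →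
        IsDomain (AddMonoidAlgebra K c.Quotient) ∧
          IsIntegrallyClosed (AddMonoidAlgebra K c.Quotient) := fun hs h₁₃ h₂₃ =>
      hs₁₂.elim
        (fun hs' => isDomain_and_isIntegrallyClosed_of_squarefree K h₄ h₃ h₁ h₂ (sym hd₃₄)
          (sym h₁₃) (sym h₂₃) hd₁₂ hs hs' (c.symm hr₃) hr₁
          fun e he he' => hleast e he' (e.symm he))
        (fun hs' => isDomain_and_isIntegrallyClosed_of_squarefree K h₄ h₃ h₂ h₁ (sym hd₃₄)
          (sym h₂₃) (sym h₁₃) (sym hd₁₂) hs hs' (c.symm hr₃) (c.symm hr₁)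
          fun e he he' => hleast e (e.symm he') (e.symm he))
    rcases hD with ⟨h₁₃, h₁₄, h₂₃, h₂₄⟩ | ⟨-, h₁₄, h₂₃, h₂₄, hs | hs⟩ |
      ⟨h₁₃, -, h₂₃, h₂₄, hs | hs⟩ | ⟨h₁₃, h₁₄, -, h₂₄, hs | hs⟩ |
      ⟨h₁₃, h₁₄, h₂₃, -, hs | hs⟩ | ⟨-, -, h₂₃, h₂₄, hs⟩ | ⟨h₁₃, h₁₄, -, -, hs⟩ |
      ⟨-, h₁₄, -, h₂₄, hs⟩ | ⟨h₁₃, -, h₂₃, -, hs⟩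
    · exact hs₁₂.elim (fun hs => of₁ hs h₁₃ h₁₄) fun hs => of₂ hs h₂₃ h₂₄
    · exact of₂ hs h₂₃ h₂₄
    · exact of₄ hs h₁₄ h₂₄
    · exact of₂ hs h₂₃ h₂₄
    · exact of₃ hs h₁₃ h₂₃
    · exact of₁ hs h₁₃ h₁₄
    · exact of₄ hs h₁₄ h₂₄
    · exact of₁ hs h₁₃ h₁₄
    · exact of₃ hs h₁₃ h₂₃
    · exact of₂ hs h₂₃ h₂₄
    · exact of₁ hs h₁₃ h₁₄
    · exact of₄ hs h₁₄ h₂₄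
    · exact of₃ hs h₁₃ h₂₃
end

section
/- Let K be a field and let S be the presented commutative monoid ⟨u₁, u₂, u₃, u₄, u₅ | u₁u₂ = u₃², u₁u₃ = u₄u₅⟩, i.e. the quotient of (Fin 5 →₀ ℕ) by the additive congruence generated by the two pairs (e₁ + e₂, 2·e₃) and (e₁ + e₃, e₄ + e₅). Then the semigroup algebra K[S] = AddMonoidAlgebra K S is an integral domain and is integrally closed (K[S] is a normal domain). -/
/-- A domain that embeds in an integrally closed domain `B` as a retract, linearly over itself,
is integrally closed. -/
theorem isIntegrallyClosed_of_linear_retraction {A B : Type*} [CommRing A] [CommRing B]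
    [IsDomain A] [IsDomain B] [IsIntegrallyClosed B] (f : A →+* B)
    (hf : Function.Injective f) (π : B → A) (hπ : ∀ a b, π (f a * b) = a * π b)
    (hπf : ∀ a, π (f a) = a) : IsIntegrallyClosed A := by
  rw [isIntegrallyClosed_iff (FractionRing A)]
  intro x hx
  let g : FractionRing A →+* FractionRing B := IsFractionRing.map hf
  have hg (a : A) : g (algebraMap A _ a) = algebraMap B _ (f a) := by
    simp [g, IsFractionRing.map]
  have hint : IsIntegral B (g x) :=
    hx.map_of_comp_eq f g (by ext a; simp [hg])
  obtain ⟨y, hy⟩ := IsIntegrallyClosed.isIntegral_iff.1 hint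
  obtain ⟨a, b, hb, rfl⟩ := IsFractionRing.div_surjective (A := A) x
  have hb0 : b ≠ 0 := nonZeroDivisors.ne_zero hb
  have hfb : algebraMap B (FractionRing B) (f b) ≠ 0 := by
    simpa [map_eq_zero_iff f hf] using hb0
  have hby : f b * y = f a := by
    apply IsFractionRing.injective B (FractionRing B)
    rw [map_mul, hy, map_div₀, hg, hg, mul_div_cancel₀ _ hfb]
  refine ⟨π y, ?_⟩
  rw [eq_div_iff (by simpa using hb0), ← map_mul, mul_comm, ← hπ, hby, hπf]

theorem AddMonoidAlgebra.comapDomain_single_eq_zero {R M N : Type*} [Semiring R] {f : M → N}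
    {r : R} {n : N} (hn : n ∉ Set.range f) (hf : Function.Injective f) :
    AddMonoidAlgebra.comapDomain f hf (AddMonoidAlgebra.single n r) = 0 := by
  ext
  simp [*]

/-- The algebra of a submonoid of a free commutative monoid closed under differences is a
normal domain. -/
theorem AddMonoidAlgebra.isDomain_and_isIntegrallyClosed_of_exact (K : Type*) [Field K]
    {M σ : Type*} [AddCommMonoid M] (φ : M →+ (σ →₀ ℕ)) (hφ : Function.Injective φ)
    (hexact : ∀ m m' n, φ m + n = φ m' → n ∈ Set.range φ) :
    IsDomain (AddMonoidAlgebra K M) ∧ IsIntegrallyClosed (AddMonoidAlgebra K M) := by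
  have : IsDomain (AddMonoidAlgebra K (σ →₀ ℕ)) :=
    inferInstanceAs (IsDomain (MvPolynomial σ K))
  have : IsIntegrallyClosed (AddMonoidAlgebra K (σ →₀ ℕ)) :=
    inferInstanceAs (IsIntegrallyClosed (MvPolynomial σ K))
  let f : AddMonoidAlgebra K M →+* AddMonoidAlgebra K (σ →₀ ℕ) :=
    AddMonoidAlgebra.mapDomainRingHom K φ
  have hf : Function.Injective f := AddMonoidAlgebra.mapDomain_injective hφ
  have hA : IsDomain (AddMonoidAlgebra K M) := hf.isDomain f
  refine ⟨hA, isIntegrallyClosed_of_linear_retraction f hf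
    (AddMonoidAlgebra.comapDomain φ hφ) (fun a b ↦ ?_) fun a ↦ ?_⟩
  · induction a using AddMonoidAlgebra.induction_linear with
    | zero => simp
    | add a a' ha ha' => simp [add_mul, ha, ha', AddMonoidAlgebra.comapDomain_add]
    | single m r =>
      induction b using AddMonoidAlgebra.induction_linear with
      | zero => simp
      | add b b' hb hb' => rw [mul_add, AddMonoidAlgebra.comapDomain_add, hb, hb',
          AddMonoidAlgebra.comapDomain_add, mul_add]
      | single n s =>
        have h : f (AddMonoidAlgebra.single m r) * AddMonoidAlgebra.single n s =
            AddMonoidAlgebra.single (φ m + n) (r * s) := by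
          simp [f, AddMonoidAlgebra.single_mul_single]
        rw [h]
        by_cases hn : n ∈ Set.range φ
        · obtain ⟨k, rfl⟩ := hn
          rw [← map_add, AddMonoidAlgebra.comapDomain_single_map,
            AddMonoidAlgebra.comapDomain_single_map, AddMonoidAlgebra.single_mul_single]
        · rw [AddMonoidAlgebra.comapDomain_single_eq_zero hn,
            AddMonoidAlgebra.comapDomain_single_eq_zero, mul_zero]
          rintro ⟨m', hm'⟩
          exact hn (hexact m m' n hm'.symm)
  · induction a using AddMonoidAlgebra.induction_linear with
    | zero => simp
    | add a a' ha ha' => rw [map_add, AddMonoidAlgebra.comapDomain_add, ha, ha']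
    | single m r => simp [f]

/-- The exponent vector `(a, b, c, d, e)`. -/
noncomputable def expVec (a b c d e : ℕ) : Fin 5 →₀ ℕ := Finsupp.equivFunOnFinite.symm ![a, b, c, d, e]

theorem eq_expVec (x : Fin 5 →₀ ℕ) : x = expVec (x 0) (x 1) (x 2) (x 3) (x 4) := by
  ext i
  fin_cases i <;> rfl

/-- The values on a monomial of the four linear forms defining the facets of the cone
of the monoid. -/
noncomputable def facetHom : (Fin 5 →₀ ℕ) →+ (Fin 4 →₀ ℕ) where
  toFun x := Finsupp.equivFunOnFinite.symm
    ![2 * x 1 + x 2 + x 4, 2 * x 1 + x 2 + x 3, 2 * x 0 + x 2 + 3 * x 4, 2 * x 0 + x 2 + 3 * x 3]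
  map_zero' := by ext i; fin_cases i <;> simp
  map_add' x y := by ext i; fin_cases i <;> simp <;> ring

theorem facetHom_eq_iff (x : Fin 5 →₀ ℕ) (y : Fin 4 →₀ ℕ) : facetHom x = y ↔
    2 * x 1 + x 2 + x 4 = y 0 ∧ 2 * x 1 + x 2 + x 3 = y 1 ∧
      2 * x 0 + x 2 + 3 * x 4 = y 2 ∧ 2 * x 0 + x 2 + 3 * x 3 = y 3 := by
  simp [Finsupp.ext_iff, Fin.forall_fin_succ, facetHom]

theorem mem_range_facetHom_iff (y : Fin 4 →₀ ℕ) : y ∈ Set.range facetHom ↔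
    y 2 + 3 * y 1 = y 3 + 3 * y 0 ∧ Even (y 0 + y 2) := by
  simp only [Set.mem_range, facetHom_eq_iff, Nat.even_iff]
  constructor
  · rintro ⟨x, h⟩
    omega
  · rintro ⟨h, h'⟩
    refine ⟨expVec
      ((y 2 - 3 * (y 0 - y 1) - min (y 0) (y 1)) / 2)
      ((min (y 0) (y 1) - (y 2 - 3 * (y 0 - y 1))) / 2)
      (min (min (y 0) (y 1)) (y 2 - 3 * (y 0 - y 1)))
      (y 1 - y 0) (y 0 - y 1), ?_⟩
    simp only [expVec, Finsupp.equivFunOnFinite_symm_apply_apply, Matrix.cons_val]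
    omega

theorem exists_normal_form (c : AddCon (Fin 5 →₀ ℕ))
    (h₁ : c (Finsupp.single 0 1 + Finsupp.single 1 1) (Finsupp.single 2 2))
    (h₂ : c (Finsupp.single 0 1 + Finsupp.single 2 1) (Finsupp.single 3 1 + Finsupp.single 4 1))
    (x : Fin 5 →₀ ℕ) : ∃ y, c x y ∧ (y 0 = 0 ∨ y 1 = 0) ∧ (y 3 = 0 ∨ y 4 = 0) := by
  have r₁ (k a b p d e) : c (expVec (a + k) (b + k) p d e) (expVec a b (p + 2 * k) d e) := by
    convert c.add (c.refl (expVec a b p d e)) (c.nsmul k h₁) using 1 <;>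
      (ext i; fin_cases i <;> simp [expVec, mul_comm])
  have r₂ (k a b p d e) : c (expVec a b p (d + k) (e + k)) (expVec (a + k) b (p + k) d e) := by
    convert c.add (c.refl (expVec a b p d e)) (c.nsmul k (c.symm h₂)) using 1 <;>
      (ext i; fin_cases i <;> simp [expVec])
  have s₁ (a b p d e) : ∃ y, c (expVec a b p d e) y ∧ (y 0 = 0 ∨ y 1 = 0) ∧
      y 3 = d ∧ y 4 = e := by
    refine ⟨expVec (a - min a b) (b - min a b) (p + 2 * min a b) d e, ?_, ?_, ?_, ?_⟩
    · convert r₁ (min a b) (a - min a b) (b - min a b) p d e using 2 <;> omega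
    · simp [expVec]; omega
    · simp [expVec]
    · simp [expVec]
  obtain ⟨y, hy, hy'⟩ := s₁ (x 0 + min (x 3) (x 4)) (x 1) (x 2 + min (x 3) (x 4))
    (x 3 - min (x 3) (x 4)) (x 4 - min (x 3) (x 4))
  refine ⟨y, c.trans ?_ hy, hy'.1, by omega⟩
  nth_rw 1 [eq_expVec x]
  convert r₂ (min (x 3) (x 4)) (x 0) (x 1) (x 2)
    (x 3 - min (x 3) (x 4)) (x 4 - min (x 3) (x 4)) using 2 <;> omega

theorem facetHom_injOn_normal_form {x y : Fin 5 →₀ ℕ} (hx : x 0 = 0 ∨ x 1 = 0)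
    (hx' : x 3 = 0 ∨ x 4 = 0) (hy : y 0 = 0 ∨ y 1 = 0) (hy' : y 3 = 0 ∨ y 4 = 0)
    (h : facetHom x = facetHom y) : x = y := by
  rw [facetHom_eq_iff] at h
  obtain ⟨h₀, h₁, h₂, h₃⟩ := h
  simp only [facetHom, AddMonoidHom.coe_mk, ZeroHom.coe_mk,
    Finsupp.equivFunOnFinite_symm_apply_apply, Matrix.cons_val] at h₀ h₁ h₂ h₃
  ext i
  fin_cases i <;> simp <;> omega

theorem stmt12 (K : Type*) [Field K]
    (c : AddCon (Fin 5 →₀ ℕ))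
    (hc : c = addConGen (fun x y =>
      (x = Finsupp.single (0 : Fin 5) 1 + Finsupp.single 1 1 ∧
        y = Finsupp.single (2 : Fin 5) 2) ∨
      (x = Finsupp.single (0 : Fin 5) 1 + Finsupp.single 2 1 ∧
        y = Finsupp.single (3 : Fin 5) 1 + Finsupp.single 4 1))) :
    IsDomain (AddMonoidAlgebra K c.Quotient) ∧
      IsIntegrallyClosed (AddMonoidAlgebra K c.Quotient) := by
  have h₁ : c (Finsupp.single 0 1 + Finsupp.single 1 1) (Finsupp.single 2 2) := by
    rw [hc]
    exact AddConGen.Rel.of _ _ (.inl ⟨rfl, rfl⟩)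
  have h₂ : c (Finsupp.single 0 1 + Finsupp.single 2 1)
      (Finsupp.single 3 1 + Finsupp.single 4 1) := by
    rw [hc]
    exact AddConGen.Rel.of _ _ (.inr ⟨rfl, rfl⟩)
  have hker : c ≤ AddCon.ker facetHom := by
    rw [hc, AddCon.addConGen_le]
    rintro x y (⟨rfl, rfl⟩ | ⟨rfl, rfl⟩) <;> rw [AddCon.ker_rel, facetHom_eq_iff] <;>
      simp [facetHom]
  have hinj {x y} (h : facetHom x = facetHom y) : c x y := by
    obtain ⟨x', hx, hx₁, hx₂⟩ := exists_normal_form c h₁ h₂ x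
    obtain ⟨y', hy, hy₁, hy₂⟩ := exists_normal_form c h₁ h₂ y
    have e : x' = y' := facetHom_injOn_normal_form hx₁ hx₂ hy₁ hy₂
      ((hker hx).symm.trans (h.trans (hker hy)))
    exact c.trans hx (e ▸ c.symm hy)
  refine AddMonoidAlgebra.isDomain_and_isIntegrallyClosed_of_exact K
    (c.lift facetHom hker) ?_ ?_
  · intro x y
    induction x using AddCon.induction_on
    induction y using AddCon.induction_on
    exact fun h ↦ (AddCon.eq c).2 (hinj h)
  · intro x y n
    induction x using AddCon.induction_on with | _ x
    induction y using AddCon.induction_on with | _ y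
    intro h
    have hx := (mem_range_facetHom_iff _).1 ⟨x, rfl⟩
    have hy := (mem_range_facetHom_iff _).1 ⟨y, rfl⟩
    have h' : facetHom x + n = facetHom y := h
    rw [← h'] at hy
    simp only [Finsupp.add_apply, Nat.even_iff] at hx hy
    obtain ⟨z, rfl⟩ := (mem_range_facetHom_iff n).2 ⟨by omega, by rw [Nat.even_iff]; omega⟩
    exact ⟨z, rfl⟩
end
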